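/- arXiv:math/0703395 — 9 statements merged into one kernel-verified Lean document; each statement's English description precedes it below -/
import Mathlib

section
/- Let h be hermitian and assume 2 is invertible in R. Then σ_A is a scalar involution on A = (D,F,h,×); that is: σ_A((α,u)·(β,v)) = σ_A((β,v))·σ_A((α,u)) for all (α,u),(β,v) ∈ A, σ_A ∘ σ_A = id, and for every x ∈ A the element σ_A(x)·x lies in the image of R under the map r ↦ ((algebraMap R D) r, 0). -/
/- Context: `R` a commutative unital ring, `D` an associative unital `R`-algebra with a
scalar involution `conj` (i.e. `conj` is `R`-linear, anti-multiplicative, of period 2,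
and all norms `conj x * x` lie in the image of `R`), `F` a right `D`-module (encoded as
a `Dᵐᵒᵖ`-module), `h : F × F → D` a sesquilinear form, and `cross` an alternating
`R`-bilinear map (a cross product).  The `R`-module `A = D × F` carries the
multiplication `(α,u)(β,v) = (αβ − h(v,u), v·α + u·β̄ + v×u)` with unit `(1,0)`.
`σ_A (α,u) = (ᾱ,-u)`, `t_A (α,u) = (ᾱ+α, 0)`, `n_A x = σ_A(x)·x`.
`h` is hermitian if `h u v = conj (h v u)` for all `u v`. -/

open MulOpposite

variable {R D F : Type*} [CommRing R] [Ring D] [Algebra R D]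
  [AddCommGroup F] [Module R F] [Module Dᵐᵒᵖ F] [IsScalarTower R Dᵐᵒᵖ F]

/-- The multiplication of `A = (D,F,h,×)`:
`(α,u)(β,v) = (αβ − h(v,u), v·α + u·β̄ + v×u)`. -/
def amul (conj : D →ₗ[R] D) (h : F → F → D) (cross : F →ₗ[R] F →ₗ[R] F)
    (x y : D × F) : D × F :=
  (x.1 * y.1 - h y.2 x.2,
    op x.1 • y.2 + op (conj y.1) • x.2 + cross y.2 x.2)

/-- The involution `σ_A (α,u) = (ᾱ, -u)`. -/
def sigmaA (conj : D →ₗ[R] D) (x : D × F) : D × F := (conj x.1, -x.2)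

/-- The trace `t_A (α,u) = (ᾱ + α, 0)`. -/
def tA (conj : D →ₗ[R] D) (x : D × F) : D × F := (conj x.1 + x.1, 0)

/-- An involution fixes the unit. -/
lemma involution_map_one (conj : D →ₗ[R] D)
    (conj_mul : ∀ x y : D, conj (x * y) = conj y * conj x)
    (conj_conj : ∀ x : D, conj (conj x) = x) : conj 1 = 1 := by
  have key := conj_mul (conj 1) 1
  rwa [mul_one, conj_conj, mul_one, eq_comm] at key

/-- The traces of a scalar involution are scalars. -/
lemma trace_mem_range_of_scalar (conj : D →ₗ[R] D)
    (conj_mul : ∀ x y : D, conj (x * y) = conj y * conj x)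
    (conj_conj : ∀ x : D, conj (conj x) = x)
    (conj_scalar : ∀ x : D, conj x * x ∈ (algebraMap R D).range) (x : D) :
    conj x + x ∈ (algebraMap R D).range := by
  have expand : conj x + x = conj (1 + x) * (1 + x) - conj x * x - 1 := by
    rw [map_add, involution_map_one conj conj_mul conj_conj]
    noncomm_ring
  rw [expand]
  exact sub_mem (sub_mem (conj_scalar _) (conj_scalar _)) (one_mem _)

/-- If `2` is invertible, the elements fixed by a scalar involution are scalars. -/
lemma mem_range_of_fixed (conj : D →ₗ[R] D)
    (conj_mul : ∀ x y : D, conj (x * y) = conj y * conj x)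
    (conj_conj : ∀ x : D, conj (conj x) = x)
    (conj_scalar : ∀ x : D, conj x * x ∈ (algebraMap R D).range)
    (two_inv : IsUnit (2 : R)) {x : D} (hx : conj x = x) :
    x ∈ (algebraMap R D).range := by
  obtain ⟨c, hc⟩ := two_inv.exists_left_inv
  obtain ⟨r, hr⟩ := trace_mem_range_of_scalar conj conj_mul conj_conj conj_scalar x
  refine ⟨c * r, ?_⟩
  rw [map_mul, hr, hx, ← two_mul, ← mul_assoc, ← map_ofNat (algebraMap R D) 2, ← map_mul, hc,
    map_one, one_mul]

/-- if `h` is hermitian and `2` is invertible in `R`, then `σ_A` is a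
scalar involution on `A = (D,F,h,×)`: it is anti-multiplicative, of period 2, and all
norms `σ_A(x)·x` lie in the image of `R` under `r ↦ (algebraMap R D r, 0)`. -/
theorem stmt0
    (conj : D →ₗ[R] D) (h : F → F → D) (cross : F →ₗ[R] F →ₗ[R] F)
    (conj_mul : ∀ x y : D, conj (x * y) = conj y * conj x)
    (conj_conj : ∀ x : D, conj (conj x) = x)
    (conj_scalar : ∀ x : D, conj x * x ∈ (algebraMap R D).range)
    (h_add_left : ∀ u u' v : F, h (u + u') v = h u v + h u' v)
    (h_add_right : ∀ u v v' : F, h u (v + v') = h u v + h u v')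
    (h_sesq : ∀ (a b : D) (u v : F), h (op a • u) (op b • v) = conj a * h u v * b)
    (cross_alt : ∀ u : F, cross u u = 0)
    (two_inv : IsUnit (2 : R))
    (h_herm : ∀ u v : F, h u v = conj (h v u))
 :
    (∀ x y : D × F, sigmaA conj (amul conj h cross x y)
        = amul conj h cross (sigmaA conj y) (sigmaA conj x)) ∧
    (∀ x : D × F, sigmaA conj (sigmaA conj x) = x) ∧
    (∀ x : D × F, ∃ r : R,
        amul conj h cross (sigmaA conj x) x = ((algebraMap R D) r, (0 : F))) := by
  have hneg_left (u v : F) : h (-u) v = -h u v :=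
    (AddMonoidHom.mk' (fun w => h w v) fun a b => h_add_left a b v).map_neg u
  have hneg_right (u v : F) : h u (-v) = -h u v :=
    (AddMonoidHom.mk' (h u) fun a b => h_add_right u a b).map_neg v
  have cross_swap : ∀ u v : F, cross u v = -cross v u := by
    intro u v
    exact (LinearMap.IsAlt.neg cross_alt v u).symm
  refine ⟨fun x y => ?_, fun x => ?_, fun x => ?_⟩
  · ext
    · simp [sigmaA, amul, conj_mul, hneg_left, hneg_right, ← h_herm]
    · simp only [sigmaA, amul, conj_conj, smul_neg, map_neg, LinearMap.neg_apply, neg_neg]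
      rw [cross_swap y.2 x.2]
      abel
  · simp [sigmaA, conj_conj]
  · obtain ⟨a, ha⟩ := conj_scalar x.1
    obtain ⟨b, hb⟩ := mem_range_of_fixed conj conj_mul conj_conj conj_scalar
      two_inv (h_herm x.2 x.2).symm
    refine ⟨a + b, ?_⟩
    ext
    · simp [sigmaA, amul, hneg_right, ha, hb]
    · simp [sigmaA, amul, cross_alt]
end

section
/- If σ_A is anti-multiplicative on A = (D,F,h,×), i.e. σ_A(x·y) = σ_A(y)·σ_A(x) for all x,y ∈ A, then h is hermitian: h(u,v) = h(v,u)‾ for all u,v ∈ F. -/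
/- Context: `R` a commutative unital ring, `D` an associative unital `R`-algebra with a
scalar involution `conj` (i.e. `conj` is `R`-linear, anti-multiplicative, of period 2,
and all norms `conj x * x` lie in the image of `R`), `F` a right `D`-module (encoded as
a `Dᵐᵒᵖ`-module), `h : F × F → D` a sesquilinear form, and `cross` an alternating
`R`-bilinear map (a cross product).  The `R`-module `A = D × F` carries the
multiplication `(α,u)(β,v) = (αβ − h(v,u), v·α + u·β̄ + v×u)` with unit `(1,0)`.
`σ_A (α,u) = (ᾱ,-u)`, `t_A (α,u) = (ᾱ+α, 0)`, `n_A x = σ_A(x)·x`.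
`h` is hermitian if `h u v = conj (h v u)` for all `u v`. -/

open MulOpposite

variable {R D F : Type*} [CommRing R] [Ring D] [Algebra R D]
  [AddCommGroup F] [Module R F] [Module Dᵐᵒᵖ F] [IsScalarTower R Dᵐᵒᵖ F]

/-- if `σ_A` is anti-multiplicative on `A = (D,F,h,×)`, then `h` is
hermitian. -/
theorem stmt1
    (conj : D →ₗ[R] D) (h : F → F → D) (cross : F →ₗ[R] F →ₗ[R] F)
    (conj_mul : ∀ x y : D, conj (x * y) = conj y * conj x)
    (conj_conj : ∀ x : D, conj (conj x) = x)
    (conj_scalar : ∀ x : D, conj x * x ∈ (algebraMap R D).range)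
    (h_add_left : ∀ u u' v : F, h (u + u') v = h u v + h u' v)
    (h_add_right : ∀ u v v' : F, h u (v + v') = h u v + h u v')
    (h_sesq : ∀ (a b : D) (u v : F), h (op a • u) (op b • v) = conj a * h u v * b)
    (cross_alt : ∀ u : F, cross u u = 0)
    (anti : ∀ x y : D × F, sigmaA conj (amul conj h cross x y)
        = amul conj h cross (sigmaA conj y) (sigmaA conj x)) :
    ∀ u v : F, h u v = conj (h v u) := by
  intro u v
  have h_neg_left (a b : F) : h (-a) b = -h a b :=
    (AddMonoidHom.mk' (fun x => h x b) fun x y => h_add_left x y b).map_neg a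
  have h_neg_right (a b : F) : h a (-b) = -h a b :=
    (AddMonoidHom.mk' (h a) (h_add_right a)).map_neg b
  have key := congrArg Prod.fst (anti (0, u) (0, v))
  simp only [sigmaA, amul, map_zero, mul_zero, zero_sub, map_neg, h_neg_left, h_neg_right,
    neg_neg, neg_inj] at key
  exact key.symm
end

section
/- If h is hermitian, then the map t : A × A → A defined by t(x,y) = t_A(x·y) on A = (D,F,h,×) is symmetric: t_A(x·y) = t_A(y·x) for all x,y ∈ A. -/
/- Context: `R` a commutative unital ring, `D` an associative unital `R`-algebra with a
scalar involution `conj` (i.e. `conj` is `R`-linear, anti-multiplicative, of period 2,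
and all norms `conj x * x` lie in the image of `R`), `F` a right `D`-module (encoded as
a `Dᵐᵒᵖ`-module), `h : F × F → D` a sesquilinear form, and `cross` an alternating
`R`-bilinear map (a cross product).  The `R`-module `A = D × F` carries the
multiplication `(α,u)(β,v) = (αβ − h(v,u), v·α + u·β̄ + v×u)` with unit `(1,0)`.
`σ_A (α,u) = (ᾱ,-u)`, `t_A (α,u) = (ᾱ+α, 0)`, `n_A x = σ_A(x)·x`.
`h` is hermitian if `h u v = conj (h v u)` for all `u v`. -/

open MulOpposite

variable {R D F : Type*} [CommRing R] [Ring D] [Algebra R D]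
  [AddCommGroup F] [Module R F] [Module Dᵐᵒᵖ F] [IsScalarTower R Dᵐᵒᵖ F]

/-- An element commutes with its image under a scalar involution. -/
lemma conj_mul_self_comm (conj : D →ₗ[R] D)
    (conj_mul : ∀ x y : D, conj (x * y) = conj y * conj x)
    (conj_conj : ∀ x : D, conj (conj x) = x)
    (conj_scalar : ∀ x : D, conj x * x ∈ (algebraMap R D).range) (x : D) :
    conj x * x = x * conj x := by
  have conj_one : conj 1 = 1 := by
    simpa [conj_conj] using (conj_mul 1 (conj 1)).symm
  obtain ⟨r, hr⟩ := conj_scalar x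
  obtain ⟨s, hs⟩ := conj_scalar (x + 1)
  have htrace : conj x = algebraMap R D (s - r - 1) - x := by
    rw [map_sub, map_sub, hr, hs, map_add, conj_one, map_one]
    noncomm_ring
  rw [htrace, sub_mul, mul_sub, Algebra.commutes]

/-- The trace of a scalar involution is symmetric on products. -/
lemma conj_trace_mul_comm (conj : D →ₗ[R] D)
    (conj_mul : ∀ x y : D, conj (x * y) = conj y * conj x)
    (conj_conj : ∀ x : D, conj (conj x) = x)
    (conj_scalar : ∀ x : D, conj x * x ∈ (algebraMap R D).range) (a b : D) :
    conj (a * b) + a * b = conj (b * a) + b * a := by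
  have key := conj_mul_self_comm conj conj_mul conj_conj conj_scalar
  have hab := key (a + conj b)
  have hb := key b
  simp only [map_add, conj_conj, add_mul, mul_add, key a, hb] at hab
  rw [conj_mul, conj_mul]
  grind

/-- if `h` is hermitian, then `t(x,y) = t_A(x·y)` is symmetric on
`A = (D,F,h,×)`. -/
theorem stmt2
    (conj : D →ₗ[R] D) (h : F → F → D) (cross : F →ₗ[R] F →ₗ[R] F)
    (conj_mul : ∀ x y : D, conj (x * y) = conj y * conj x)
    (conj_conj : ∀ x : D, conj (conj x) = x)
    (conj_scalar : ∀ x : D, conj x * x ∈ (algebraMap R D).range)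
    (h_add_left : ∀ u u' v : F, h (u + u') v = h u v + h u' v)
    (h_add_right : ∀ u v v' : F, h u (v + v') = h u v + h u v')
    (h_sesq : ∀ (a b : D) (u v : F), h (op a • u) (op b • v) = conj a * h u v * b)
    (cross_alt : ∀ u : F, cross u u = 0)
    (h_herm : ∀ u v : F, h u v = conj (h v u))
 :
    ∀ x y : D × F, tA conj (amul conj h cross x y) = tA conj (amul conj h cross y x) := by
  intro x y
  refine Prod.ext ?_ rfl
  have htr := conj_trace_mul_comm conj conj_mul conj_conj conj_scalar x.1 y.1
  simp only [tA, amul, map_sub]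
  rw [← h_herm, ← h_herm, sub_add_sub_comm, sub_add_sub_comm, htr, add_comm (h x.2 y.2)]
end

section
/- Assume 2 is invertible in R and h is hermitian. Then A = (D,F,h,×) is a quadratic R-algebra with scalar involution σ_A: for every x = (α,u) ∈ A one has σ_A(x)·x = (ᾱα + h(u,u), 0), this element lies in the image of R under r ↦ ((algebraMap R D) r, 0), and x·x − t_A(x)·x + σ_A(x)·x = 0, where t_A(x)·x denotes the product in A of the element t_A(x) = (ᾱ+α, 0) with x. -/
/- Context: `R` a commutative unital ring, `D` an associative unital `R`-algebra with a
scalar involution `conj` (i.e. `conj` is `R`-linear, anti-multiplicative, of period 2,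
and all norms `conj x * x` lie in the image of `R`), `F` a right `D`-module (encoded as
a `Dᵐᵒᵖ`-module), `h : F × F → D` a sesquilinear form, and `cross` an alternating
`R`-bilinear map (a cross product).  The `R`-module `A = D × F` carries the
multiplication `(α,u)(β,v) = (αβ − h(v,u), v·α + u·β̄ + v×u)` with unit `(1,0)`.
`σ_A (α,u) = (ᾱ,-u)`, `t_A (α,u) = (ᾱ+α, 0)`, `n_A x = σ_A(x)·x`.
`h` is hermitian if `h u v = conj (h v u)` for all `u v`. -/

open MulOpposite

variable {R D F : Type*} [CommRing R] [Ring D] [Algebra R D]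
  [AddCommGroup F] [Module R F] [Module Dᵐᵒᵖ F] [IsScalarTower R Dᵐᵒᵖ F]

/-- An involution maps `1` to `1`. -/
theorem conj_one_of_involution {R D : Type*} [CommRing R] [Ring D] [Algebra R D]
    (conj : D →ₗ[R] D) (conj_mul : ∀ x y : D, conj (x * y) = conj y * conj x)
    (conj_conj : ∀ x : D, conj (conj x) = x) : conj 1 = 1 := by
  simpa [conj_conj] using (conj_mul (conj 1) 1).symm

/-- The traces of a scalar involution are scalars. -/
theorem conj_add_self_mem_range {R D : Type*} [CommRing R] [Ring D] [Algebra R D]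
    (conj : D →ₗ[R] D) (conj_mul : ∀ x y : D, conj (x * y) = conj y * conj x)
    (conj_conj : ∀ x : D, conj (conj x) = x)
    (conj_scalar : ∀ x : D, conj x * x ∈ (algebraMap R D).range) (a : D) :
    conj a + a ∈ (algebraMap R D).range := by
  have key : conj a + a = conj (1 + a) * (1 + a) - conj a * a - 1 := by
    rw [map_add, conj_one_of_involution conj conj_mul conj_conj]
    noncomm_ring
  rw [key]
  exact sub_mem (sub_mem (conj_scalar _) (conj_scalar _)) (one_mem _)

/-- If `2` is invertible, the symmetric elements of a scalar involution are scalars. -/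
theorem mem_range_of_conj_eq_self {R D : Type*} [CommRing R] [Ring D] [Algebra R D]
    (conj : D →ₗ[R] D) (conj_mul : ∀ x y : D, conj (x * y) = conj y * conj x)
    (conj_conj : ∀ x : D, conj (conj x) = x)
    (conj_scalar : ∀ x : D, conj x * x ∈ (algebraMap R D).range)
    (two_inv : IsUnit (2 : R)) {a : D} (ha : conj a = a) :
    a ∈ (algebraMap R D).range := by
  obtain ⟨r, hr⟩ := conj_add_self_mem_range conj conj_mul conj_conj conj_scalar a
  obtain ⟨c, hc⟩ := two_inv.exists_left_inv
  refine ⟨c * r, ?_⟩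
  rw [map_mul, hr, ha, ← Algebra.smul_def, ← two_smul R a, smul_smul, hc, one_smul]

/-- if `2` is invertible in `R` and `h` is hermitian, then
`A = (D,F,h,×)` is a quadratic `R`-algebra with scalar involution `σ_A`:
`σ_A(x)·x = (ᾱα + h(u,u), 0)`, this element lies in the image of `R`, and
`x·x − t_A(x)·x + σ_A(x)·x = 0`. -/
theorem stmt3
    (conj : D →ₗ[R] D) (h : F → F → D) (cross : F →ₗ[R] F →ₗ[R] F)
    (conj_mul : ∀ x y : D, conj (x * y) = conj y * conj x)
    (conj_conj : ∀ x : D, conj (conj x) = x)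
    (conj_scalar : ∀ x : D, conj x * x ∈ (algebraMap R D).range)
    (h_add_left : ∀ u u' v : F, h (u + u') v = h u v + h u' v)
    (h_add_right : ∀ u v v' : F, h u (v + v') = h u v + h u v')
    (h_sesq : ∀ (a b : D) (u v : F), h (op a • u) (op b • v) = conj a * h u v * b)
    (cross_alt : ∀ u : F, cross u u = 0)
    (two_inv : IsUnit (2 : R))
    (h_herm : ∀ u v : F, h u v = conj (h v u))
 :
    ∀ (α : D) (u : F),
      amul conj h cross (sigmaA conj (α, u)) (α, u) = (conj α * α + h u u, (0 : F)) ∧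
      (∃ r : R, amul conj h cross (sigmaA conj (α, u)) (α, u)
          = ((algebraMap R D) r, (0 : F))) ∧
      amul conj h cross (α, u) (α, u) - amul conj h cross (tA conj (α, u)) (α, u)
          + amul conj h cross (sigmaA conj (α, u)) (α, u) = 0 := by
  have h_zero : ∀ u : F, h u 0 = 0 := fun u => by
    simpa using h_add_right u 0 0
  have h_neg : ∀ u v : F, h u (-v) = -h u v := fun u v => by
    rw [eq_neg_iff_add_eq_zero, ← h_add_right, neg_add_cancel, h_zero]
  intro α u
  have norm_eq : amul conj h cross (sigmaA conj (α, u)) (α, u)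
      = (conj α * α + h u u, (0 : F)) := by
    simp [amul, sigmaA, h_neg, cross_alt]
  refine ⟨norm_eq, ?_, ?_⟩
  · have h_mem : h u u ∈ (algebraMap R D).range :=
      mem_range_of_conj_eq_self conj conj_mul conj_conj conj_scalar two_inv (h_herm u u).symm
    obtain ⟨r, hr⟩ := add_mem (conj_scalar α) h_mem
    exact ⟨r, by rw [norm_eq, hr]⟩
  · rw [norm_eq]
    ext
    · simp only [amul, tA, Prod.fst_add, Prod.fst_sub, Prod.fst_zero, h_zero]
      noncomm_ring
    · simp only [amul, tA, Prod.snd_add, Prod.snd_sub, Prod.snd_zero, cross_alt, map_zero,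
        smul_zero, op_add, add_smul]
      abel
end

section
/- The norm n of C = (R,F,B,×) permits composition: n(x·y) = n(x)·n(y) for all x,y ∈ C. -/
/- Context: `R` a commutative unital ring, `F` an `R`-module, `B` a symmetric
`R`-bilinear form on `F`, and `cross` an alternating `R`-bilinear map (a cross
product).  `A = R × F` carries the multiplication
`(a,u)(b,v) = (ab − B(u,v), a•v + b•u + v×u)` with unit `(1,0)`. -/

variable {R F : Type*} [CommRing R] [AddCommGroup F] [Module R F]

/-- The multiplication of `(R,F,B,×)`:
`(a,u)(b,v) = (ab − B(u,v), a•v + b•u + v×u)`. -/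
def bmul (B : F →ₗ[R] F →ₗ[R] R) (cross : F →ₗ[R] F →ₗ[R] F)
    (x y : R × F) : R × F :=
  (x.1 * y.1 - B x.2 y.2, x.1 • y.2 + y.1 • x.2 + cross y.2 x.2)

/-- the norm `n(a,u) = a² + B(u,u)` of `C = (R,F,B,×)` permits
composition: `n(x·y) = n(x)·n(y)` for all `x y ∈ C`. -/
theorem stmt10
    [Invertible (2 : R)] [Module.Finite R F] [Module.Projective R F]
    (B : F →ₗ[R] F →ₗ[R] R) (cross : F →ₗ[R] F →ₗ[R] F)
    (B_symm : ∀ u v : F, B u v = B v u)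
    (B_nondeg : ∀ f : F →ₗ[R] R, ∃! u : F, B u = f)
    (cross_alt : ∀ u : F, cross u u = 0)
    (hyp1 : ∀ u v : F, B (cross u v) (cross u v) = B u u * B v v - (B u v) ^ 2)
    (hyp2 : ∀ u v : F, B u (cross u v) = 0)
 :
    ∀ x y : R × F,
      ((bmul B cross x y).1 ^ 2 + B (bmul B cross x y).2 (bmul B cross x y).2)
        = (x.1 ^ 2 + B x.2 x.2) * (y.1 ^ 2 + B y.2 y.2) := by
  rintro ⟨a, u⟩ ⟨b, v⟩
  have cross_swap : cross v u = -cross u v := by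
    have h := cross_alt (u + v)
    simp only [map_add, LinearMap.add_apply, cross_alt, zero_add, add_zero] at h
    exact eq_neg_of_add_eq_zero_left h
  have hu : B u (cross v u) = 0 := by rw [cross_swap, map_neg, hyp2, neg_zero]
  have hv : B v (cross v u) = 0 := hyp2 v u
  simp only [bmul, map_add, map_smul, LinearMap.add_apply, LinearMap.smul_apply, smul_eq_mul,
    B_symm (cross v u) u, B_symm (cross v u) v, hu, hv, hyp1, B_symm v u]
  ring
end

section
/- With F = {x ∈ C : t(x) = 0}, the following hold: (a) C is the internal direct sum of R·1 and F as R-modules; (b) for all u,v ∈ F the element u×v := (1/2)(uv − vu) lies in F, and the map (u,v) ↦ u×v is an alternating R-bilinear map F × F → F; (c) the map B : F × F → R, B(u,v) = (1/2)·n(u,v), is a symmetric R-bilinear form satisfying B(u×v, u×v) = B(u,u)·B(v,v) − B(u,v)² and B(u, u×v) = 0 for all u,v ∈ F. -/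
/- Context: `R` a commutative unital ring with `2` invertible, `C` a unital
(not necessarily associative) `R`-algebra, finitely generated faithfully projective
as an `R`-module, which is alternative, carrying a nondegenerate multiplicative
quadratic form `n` with `n 1 = 1` which is the norm of `C` as a quadratic algebra.
The trace is `t x = n(1,x)` (polar form), and `F = ker t`. -/

open QuadraticMap

section NormIdentities

variable {R C : Type*} [CommRing R] [NonAssocRing C] [Module R C]

theorem QuadraticForm.polar_mul_left_of_map_mul {n : QuadraticForm R C}
    (hcomp : ∀ x y : C, n (x * y) = n x * n y) (x y z : C) :
    polar n (x * y) (x * z) = n x * polar n y z := by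
  simp only [polar, ← mul_add, hcomp]
  ring

theorem QuadraticForm.polar_mul_right_of_map_mul {n : QuadraticForm R C}
    (hcomp : ∀ x y : C, n (x * y) = n x * n y) (x y z : C) :
    polar n (x * z) (y * z) = polar n x y * n z := by
  simp only [polar, ← add_mul, hcomp]
  ring

/-- The trace of a product in an algebra with multiplicative norm. -/
theorem QuadraticForm.polar_one_mul_of_map_mul {n : QuadraticForm R C}
    (hcomp : ∀ x y : C, n (x * y) = n x * n y) (x y : C) :
    polar n 1 (x * y) = polar n 1 x * polar n 1 y - polar n x y := by
  have h := polar_mul_right_of_map_mul hcomp 1 x (1 + y)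
  have h1 := polar_mul_right_of_map_mul hcomp 1 x 1
  have h2 := polar_mul_right_of_map_mul hcomp 1 x y
  have h3 : n (1 + y) = polar n 1 y + n 1 + n y := by simp only [polar]; ring
  simp only [one_mul, mul_one, mul_add, polar_add_left, polar_add_right, h3] at h h1 h2
  rw [polar_comm n y x] at h
  linear_combination h - h1 - h2

theorem QuadraticForm.mul_add_mul_of_quadratic {n : QuadraticForm R C}
    (hquad : ∀ x : C, x * x - polar n 1 x • x + n x • (1 : C) = 0) {u v : C}
    (hu : polar n 1 u = 0) (hv : polar n 1 v = 0) :
    u * v + v * u = -(polar n u v • (1 : C)) := by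
  have h := hquad (u + v)
  have h1 := hquad u
  have h2 := hquad v
  have h3 : n (u + v) = n u + n v + polar n u v := by simp only [polar]; ring
  simp only [polar_add_right, hu, hv, h3, add_zero, zero_smul, sub_zero, mul_add, add_mul,
    add_smul] at h h1 h2
  rw [← sub_eq_zero]
  calc _ = (u * u + v * u + (u * v + v * v) +
        (n u • (1 : C) + n v • (1 : C) + polar n u v • (1 : C))) -
        (u * u + n u • (1 : C)) - (v * v + n v • (1 : C)) := by abel
    _ = 0 := by rw [h, h1, h2, sub_zero, sub_zero]

end NormIdentities

/-- with `F = {x ∈ C | t x = 0}`: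
(a) `C` is the internal direct sum of `R·1` and `F`;
(b) for `u v ∈ F` the element `u×v = (1/2)(uv − vu)` lies in `F` and
    `(u,v) ↦ u×v` is an alternating `R`-bilinear map `F × F → F`;
(c) `B(u,v) = (1/2)·n(u,v)` is a symmetric `R`-bilinear form satisfying
    `B(u×v,u×v) = B(u,u)B(v,v) − B(u,v)²` and `B(u,u×v) = 0` for all `u v ∈ F`. -/
theorem stmt13 {R C : Type*} [CommRing R] [Invertible (2 : R)]
    [NonAssocRing C] [Module R C] [SMulCommClass R C C] [IsScalarTower R C C]
    [Module.Finite R C] [Module.Projective R C] [FaithfulSMul R C]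
    (alt : ∀ x y : C, x * (x * y) = (x * x) * y ∧ (y * x) * x = y * (x * x))
    (n : QuadraticForm R C)
    (hn1 : n 1 = 1)
    (hquad : ∀ x : C, x * x - polar n 1 x • x + n x • (1 : C) = 0)
    (hcomp : ∀ x y : C, n (x * y) = n x * n y)
    (hnondeg : ∀ f : C →ₗ[R] R, ∃! x : C, ∀ y : C, polar n x y = f y) :
    -- the trace, the subspace `F`, the cross product and the bilinear form:
    let t : C → R := fun x => polar n 1 x
    let Fs : Set C := {x : C | t x = 0}
    let cr : C → C → C := fun u v => (⅟2 : R) • (u * v - v * u)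
    let B : C → C → R := fun u v => (⅟2 : R) * polar n u v
    -- (a)
    ((∀ x : C, ∃ (r : R) (f : C), f ∈ Fs ∧ x = r • (1 : C) + f) ∧
      (∀ (r : R) (f : C), f ∈ Fs → r • (1 : C) + f = 0 → r = 0 ∧ f = 0)) ∧
    -- (b)
    ((∀ u ∈ Fs, ∀ v ∈ Fs, cr u v ∈ Fs) ∧
      (∀ u : C, cr u u = 0) ∧
      (∀ u u' v : C, cr (u + u') v = cr u v + cr u' v) ∧
      (∀ u v v' : C, cr u (v + v') = cr u v + cr u v') ∧
      (∀ (r : R) (u v : C), cr (r • u) v = r • cr u v ∧ cr u (r • v) = r • cr u v)) ∧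
    -- (c)
    ((∀ u v : C, B u v = B v u) ∧
      (∀ u u' v : C, B (u + u') v = B u v + B u' v) ∧
      (∀ (r : R) (u v : C), B (r • u) v = r * B u v) ∧
      (∀ u ∈ Fs, ∀ v ∈ Fs,
        B (cr u v) (cr u v) = B u u * B v v - (B u v) ^ 2 ∧ B u (cr u v) = 0)) := by
  intro t Fs cr B
  have h2 : (⅟2 : R) * 2 = 1 := invOf_mul_self' 2
  have t1 : polar n 1 1 = 2 := by rw [polar_self, hn1]; simp
  have cr_eq : ∀ u ∈ Fs, ∀ v ∈ Fs, cr u v = u * v + (⅟2 * polar n u v) • (1 : C) := by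
    intro u hu v hv
    have h : v * u = -(polar n u v • (1 : C)) - u * v :=
      eq_sub_of_add_eq' (QuadraticForm.mul_add_mul_of_quadratic hquad hu hv)
    have h' : u * v - v * u = (2 : R) • (u * v) + polar n u v • (1 : C) := by
      rw [h, two_smul]; abel
    simp only [cr]
    rw [h', smul_add, smul_smul, smul_smul, h2, one_smul]
  have tr_mul : ∀ u ∈ Fs, ∀ v ∈ Fs, polar n 1 (u * v) = -polar n u v := by
    intro u hu v hv
    have hu : polar n 1 u = 0 := hu
    rw [QuadraticForm.polar_one_mul_of_map_mul hcomp, hu]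
    ring
  refine ⟨⟨fun x => ⟨⅟2 * polar n 1 x, x - (⅟2 * polar n 1 x) • (1 : C), ?_, by abel⟩, ?_⟩,
    ⟨?_, ?_, ?_, ?_, ?_⟩, ?_, ?_, ?_, ?_⟩
  · change polar n 1 _ = 0
    rw [polar_sub_right, polar_smul_right, t1, smul_eq_mul]
    linear_combination -polar n 1 x * h2
  · intro r f hf h
    have hf : polar n 1 f = 0 := hf
    have hr : r = 0 := by
      have h' := congrArg (polar n 1) h
      rw [polar_add_right, polar_smul_right, t1, hf, polar_zero_right, smul_eq_mul] at h'
      linear_combination ⅟2 * h' - r * h2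
    exact ⟨hr, by simpa [hr] using h⟩
  · intro u hu v hv
    change polar n 1 (cr u v) = 0
    rw [cr_eq u hu v hv, polar_add_right, polar_smul_right, t1, tr_mul u hu v hv, smul_eq_mul]
    linear_combination polar n u v * h2
  · intro u
    simp [cr]
  · intro u u' v
    simp only [cr, ← smul_add, add_mul, mul_add]
    congr 1
    abel
  · intro u v v'
    simp only [cr, ← smul_add, add_mul, mul_add]
    congr 1
    abel
  · intro r u v
    simp only [cr, smul_mul_assoc, mul_smul_comm, ← smul_sub]
    exact ⟨smul_comm _ _ _, smul_comm _ _ _⟩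
  · intro u v
    simp only [B, polar_comm n u v]
  · intro u u' v
    simp only [B, polar_add_left, mul_add]
  · intro r u v
    simp only [B, polar_smul_left, smul_eq_mul]
    ring
  · intro u hu v hv
    have hu' : polar n 1 u = 0 := hu
    have hv' : polar n 1 v = 0 := hv
    simp only [B]
    rw [cr_eq u hu v hv]
    have key : n (u * v + (⅟2 * polar n u v) • (1 : C)) =
        n u * n v - (⅟2 * polar n u v) ^ 2 := by
      rw [QuadraticMap.map_add n, hcomp, QuadraticMap.map_smul, hn1, polar_smul_right,
        polar_comm n (u * v) 1, tr_mul u hu v hv, smul_eq_mul, smul_eq_mul]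
      linear_combination ⅟2 * polar n u v ^ 2 * h2
    constructor
    · simp only [polar_self, key, nsmul_eq_mul, Nat.cast_ofNat]
      linear_combination
        (-(⅟2 * 2 * (n u * n v)) - (⅟2 * polar n u v) ^ 2) * h2
    · have h := QuadraticForm.polar_mul_left_of_map_mul hcomp u 1 v
      rw [mul_one, hv', mul_zero] at h
      rw [polar_add_right, polar_smul_right, polar_comm n u 1, hu', h]
      simp
end

section
/- For every u ∈ F one has π_F(u·u) = 0; consequently the R-bilinear map × : F × F → F, u×v = π_F(v·u), is alternating, i.e. a cross product on F. -/
/- Context: `R` a commutative unital ring, `A` a unital (not necessarily associative)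
`R`-algebra with a scalar involution `σ` (R-linear, anti-multiplicative, of period 2,
with `σ(x)·x ∈ R·1` for all `x`).  `D ⊆ A` is a unital `R`-subalgebra (a submodule
containing `1` and closed under multiplication), and
`F = D^⊥ = {x ∈ A | σ(d)·x + σ(x)·d = 0 for all d ∈ D}` is the orthogonal complement
of `D` with respect to the polar form of the norm.  `A` is assumed to be the internal
direct sum of `D` and `F`, with projections `πD` and `πF`. -/

/-- for every `u ∈ F = D^⊥` one has `π_F(u·u) = 0`; consequently the
`R`-bilinear map `× : F × F → F`, `u×v = π_F(v·u)`, is alternating, i.e. a cross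
product on `F`. -/
theorem stmt14
    {R A : Type*} [CommRing R] [NonAssocRing A] [Module R A]
    [SMulCommClass R A A] [IsScalarTower R A A]
    (σ : A →ₗ[R] A)
    (σ_mul : ∀ x y : A, σ (x * y) = σ y * σ x)
    (σ_invol : ∀ x : A, σ (σ x) = x)
    (σ_scalar : ∀ x : A, ∃ r : R, σ x * x = r • (1 : A))
    (D : Submodule R A) (one_mem : (1 : A) ∈ D)
    (D_mul : ∀ x ∈ D, ∀ y ∈ D, x * y ∈ D)
    (πD πF : A →ₗ[R] A)
    (proj_sum : ∀ x : A, πD x + πF x = x)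
    (πD_mem : ∀ x : A, πD x ∈ D)
    (πF_mem : ∀ x : A, πF x ∈ {x : A | ∀ d ∈ D, σ d * x + σ x * d = 0})
    (πD_id : ∀ x ∈ D, πD x = x)
    (πF_id : ∀ x ∈ {x : A | ∀ d ∈ D, σ d * x + σ x * d = 0}, πF x = x)
 :
    ∀ u ∈ {x : A | ∀ d ∈ D, σ d * x + σ x * d = 0}, πF (u * u) = 0 := by
  intro u hu
  have σ_one : σ 1 = 1 := by
    have h := σ_mul (σ 1) 1
    rwa [mul_one, σ_invol, mul_one, eq_comm] at h
  have σ_u : σ u = -u := by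
    have h := hu 1 one_mem
    rw [σ_one, one_mul, mul_one] at h
    exact (neg_eq_of_add_eq_zero_right h).symm
  obtain ⟨r, hr⟩ := σ_scalar u
  rw [σ_u, neg_mul] at hr
  have sq_mem : u * u ∈ D := by
    rw [← neg_neg (u * u), hr]
    exact D.neg_mem (D.smul_mem r one_mem)
  simpa [πD_id _ sq_mem] using proj_sum (u * u)
end

section
/- Define h : F × F → D by h(u,v) = −π_D(v·u). Then for all u,v ∈ F one has h(u,v) + σ(h(u,v)) = σ(u)·v + σ(v)·u (i.e. t_D(h(u,v)) equals n(u,v)·1, the polar form of the norm evaluated at (u,v)), and σ(h(u,v)) = h(v,u). -/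
/- Context: `R` a commutative unital ring, `A` a unital (not necessarily associative)
`R`-algebra with a scalar involution `σ` (R-linear, anti-multiplicative, of period 2,
with `σ(x)·x ∈ R·1` for all `x`).  `D ⊆ A` is a unital `R`-subalgebra (a submodule
containing `1` and closed under multiplication), and
`F = D^⊥ = {x ∈ A | σ(d)·x + σ(x)·d = 0 for all d ∈ D}` is the orthogonal complement
of `D` with respect to the polar form of the norm.  `A` is assumed to be the internal
direct sum of `D` and `F`, with projections `πD` and `πF`. -/

/-- define `h : F × F → D` by `h(u,v) = −π_D(v·u)`.  Then for all
`u, v ∈ F = D^⊥` one has `h(u,v) + σ(h(u,v)) = σ(u)·v + σ(v)·u` (i.e. the trace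
`t_D(h(u,v))` equals the polar form of the norm at `(u,v)`), and
`σ(h(u,v)) = h(v,u)`. -/
theorem stmt15
    {R A : Type*} [CommRing R] [NonAssocRing A] [Module R A]
    [SMulCommClass R A A] [IsScalarTower R A A]
    (σ : A →ₗ[R] A)
    (σ_mul : ∀ x y : A, σ (x * y) = σ y * σ x)
    (σ_invol : ∀ x : A, σ (σ x) = x)
    (σ_scalar : ∀ x : A, ∃ r : R, σ x * x = r • (1 : A))
    (D : Submodule R A) (one_mem : (1 : A) ∈ D)
    (D_mul : ∀ x ∈ D, ∀ y ∈ D, x * y ∈ D)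
    (πD πF : A →ₗ[R] A)
    (proj_sum : ∀ x : A, πD x + πF x = x)
    (πD_mem : ∀ x : A, πD x ∈ D)
    (πF_mem : ∀ x : A, πF x ∈ {x : A | ∀ d ∈ D, σ d * x + σ x * d = 0})
    (πD_id : ∀ x ∈ D, πD x = x)
    (πF_id : ∀ x ∈ {x : A | ∀ d ∈ D, σ d * x + σ x * d = 0}, πF x = x)
 :
    ∀ u ∈ {x : A | ∀ d ∈ D, σ d * x + σ x * d = 0},
    ∀ v ∈ {x : A | ∀ d ∈ D, σ d * x + σ x * d = 0},
      (-πD (v * u) + σ (-πD (v * u)) = σ u * v + σ v * u) ∧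
      σ (-πD (v * u)) = -πD (u * v) := by
  have polar_scalar (x y : A) : ∃ r : R, σ x * y + σ y * x = r • (1 : A) := by
    obtain ⟨a, ha⟩ := σ_scalar (x + y)
    obtain ⟨b, hb⟩ := σ_scalar x
    obtain ⟨c, hc⟩ := σ_scalar y
    refine ⟨a - b - c, ?_⟩
    rw [sub_smul, sub_smul, ← ha, ← hb, ← hc, map_add, add_mul, mul_add, mul_add]
    abel
  have σ_one : σ 1 = 1 := by
    have h := σ_mul 1 (σ 1)
    rwa [one_mul, σ_invol, one_mul, eq_comm] at h
  have polar_mem (x y : A) : σ x * y + σ y * x ∈ D := by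
    obtain ⟨r, hr⟩ := polar_scalar x y
    exact hr ▸ D.smul_mem r one_mem
  have σ_mem (d : A) (hd : d ∈ D) : σ d ∈ D := by
    have h := polar_mem d 1
    rw [mul_one, σ_one, one_mul] at h
    exact (D.add_mem_iff_left hd).1 h
  have σ_perp (x : A) (hx : ∀ d ∈ D, σ d * x + σ x * d = 0) : σ x = -x := by
    have h := hx 1 one_mem
    rw [σ_one, one_mul, mul_one] at h
    exact (neg_eq_of_add_eq_zero_right h).symm
  have πD_πF (x : A) : πD (πF x) = 0 := by
    have h := proj_sum (πF x)
    rwa [πF_id _ (πF_mem x), add_eq_right] at h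
  have πD_σ (x : A) : πD (σ x) = σ (πD x) := by
    conv_lhs => rw [← proj_sum x]
    rw [map_add, map_add, σ_perp _ (πF_mem x), map_neg, πD_πF, neg_zero, add_zero,
      πD_id _ (σ_mem _ (πD_mem x))]
  intro u hu v hv
  have σ_swap : σ (πD (v * u)) = πD (u * v) := by
    rw [← πD_σ, σ_mul, σ_perp u hu, σ_perp v hv, neg_mul_neg]
  have h_symm : σ (-πD (v * u)) = -πD (u * v) := by rw [map_neg, σ_swap]
  refine ⟨?_, h_symm⟩
  rw [h_symm, ← πD_id _ (polar_mem u v), σ_perp u hu, σ_perp v hv, neg_mul, neg_mul,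
    map_add, map_neg, map_neg, add_comm]
end

section
/- Let (e,e') be an element of the nucleus of A = (S,F,μh,×), i.e. ((e,e')·x)·y = (e,e')·(x·y), (x·(e,e'))·y = x·((e,e')·y), and (x·y)·(e,e') = x·(y·(e,e')) for all x,y ∈ A. Then e' = 0; in other words, the nucleus N(A) is contained in S × {0}. -/
/- Context: `R` a commutative unital ring, `S` a commutative associative unital
`R`-algebra which is an integral domain, with an involution `conj` (an `R`-algebra
automorphism of order 2) such that `conj s * s` lies in the image of `R`.  `F` is a
torsion-free `S`-module, `h` a nondegenerate hermitian form on `F`, `μ ∈ S` an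
invertible element with `μ̄ ≠ μ`, and `cross` an alternating `R`-bilinear map on `F`.
`A = (S,F,μh,×)` is the `R`-algebra on `S × F` with multiplication
`(α,u)(β,v) = (αβ − μ·h(v,u), v·α + u·β̄ + v×u)` and unit `(1,0)`. -/

/-- The multiplication of `A = (S,F,μh,×)`. -/
def smul16 {R S F : Type*} [CommRing R] [CommRing S] [Algebra R S]
    [AddCommGroup F] [Module S F] [Module R F] [IsScalarTower R S F]
    (conj : S →ₐ[R] S) (h : F → F → S) (μ : S) (cross : F →ₗ[R] F →ₗ[R] F)
    (x y : S × F) : S × F :=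
  (x.1 * y.1 - μ * h y.2 x.2, x.1 • y.2 + conj y.1 • x.2 + cross y.2 x.2)

/-- if `(e,e')` lies in the nucleus of `A = (S,F,μh,×)` (all three
associator conditions hold), then `e' = 0`; in other words `N(A) ⊆ S × {0}`. -/
theorem stmt16 {R S F : Type*} [CommRing R] [CommRing S] [IsDomain S] [Algebra R S]
    [AddCommGroup F] [Module S F] [Module R F] [IsScalarTower R S F]
    (conj : S →ₐ[R] S)
    (conj_invol : ∀ s : S, conj (conj s) = s)
    (conj_scalar : ∀ s : S, conj s * s ∈ (algebraMap R S).range)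
    (F_tf : ∀ s : S, s ≠ 0 → Function.Injective fun x : F => s • x)
    (h : F → F → S)
    (h_add_left : ∀ u u' v : F, h (u + u') v = h u v + h u' v)
    (h_add_right : ∀ u v v' : F, h u (v + v') = h u v + h u v')
    (h_sesq : ∀ (a b : S) (u v : F), h (a • u) (b • v) = conj a * h u v * b)
    (h_herm : ∀ u v : F, h u v = conj (h v u))
    (h_nondeg : ∀ e : F, (∀ w : F, h w e = 0) → e = 0)
    (μ : S) (hμ : IsUnit μ) (hμ' : conj μ ≠ μ)
    (cross : F →ₗ[R] F →ₗ[R] F) (cross_alt : ∀ u : F, cross u u = 0)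
    (e : S) (e' : F)
    (nuc : ∀ x y : S × F,
      smul16 conj h μ cross (smul16 conj h μ cross (e, e') x) y
        = smul16 conj h μ cross (e, e') (smul16 conj h μ cross x y) ∧
      smul16 conj h μ cross (smul16 conj h μ cross x (e, e')) y
        = smul16 conj h μ cross x (smul16 conj h μ cross (e, e') y) ∧
      smul16 conj h μ cross (smul16 conj h μ cross x y) (e, e')
        = smul16 conj h μ cross x (smul16 conj h μ cross y (e, e'))) :
    e' = 0 := by
  have h_zero_right : ∀ v, h v 0 = 0 := fun v => by simpa using h_add_right v 0 0
  have cross_skew : ∀ u v, cross u v = -cross v u := fun u v => by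
    have key := cross_alt (u + v)
    simp only [map_add, LinearMap.add_apply, cross_alt, zero_add, add_zero] at key
    rw [eq_neg_iff_add_eq_zero, add_comm]
    exact key
  have eq_zero_of_smul : ∀ s : S, s ≠ 0 → ∀ x : F, s • x = 0 → x = 0 := fun s hs x hx =>
    F_tf s hs (by simpa using hx)
  have cross_smul_right : ∀ (α : S) (v : F), cross v (α • e') = α • cross v e' := fun α v => by
    have key := congrArg Prod.snd (nuc (α, 0) (0, v)).2.1
    simp [smul16, h_zero_right, smul_smul] at key
    exact key
  have cross_smul_left : ∀ (β : S) (u : F), cross (β • e') u = β • cross e' u := fun β u => by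
    rw [cross_skew, cross_smul_right, cross_skew, smul_neg, neg_neg]
  have left_snd : ∀ v : F, -(μ * h e' e') • v = -(conj μ * h e' v) • e'
      + cross (cross v e') e' := fun v => by
    have key := congrArg Prod.snd (nuc (0, e') (0, v)).1
    simp [smul16, cross_alt, cross_smul_right, ← h_herm] at key
    linear_combination (norm := module) key
  have right_snd : ∀ u : F, -(μ * h e' u) • e' + cross e' (cross e' u)
      = -(conj μ * h e' e') • u := fun u => by
    have key := congrArg Prod.snd (nuc (0, u) (0, e')).2.2
    simp [smul16, cross_alt, cross_smul_left, ← h_herm] at key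
    linear_combination (norm := module) key
  have sub_ne : conj μ - μ ≠ 0 := sub_ne_zero.mpr hμ'
  by_contra he'
  have eq_zero_of_smul_e' : ∀ s : S, s • e' = 0 → s = 0 := fun s hs => by
    by_contra h0
    exact he' (eq_zero_of_smul s h0 e' hs)
  have isotropic : h e' e' = 0 := by
    have key := left_snd e'
    rw [cross_alt, map_zero, LinearMap.zero_apply, add_zero] at key
    refine (mul_eq_zero.mp (eq_zero_of_smul_e' ((conj μ - μ) * h e' e') ?_)).resolve_left sub_ne
    linear_combination (norm := module) key
  refine he' (h_nondeg e' fun v => ?_)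
  have h_left : h e' v = 0 := by
    have hl := left_snd v
    have hr := right_snd v
    rw [isotropic, mul_zero, neg_zero, zero_smul] at hl hr
    have flip : cross (cross v e') e' = cross e' (cross e' v) := by
      rw [cross_skew v e', cross_skew, map_neg, neg_neg]
    rw [flip] at hl
    refine (mul_eq_zero.mp (eq_zero_of_smul_e' ((conj μ - μ) * h e' v) ?_)).resolve_left sub_ne
    linear_combination (norm := module) hl + hr
  rw [h_herm, h_left, map_zero]
end
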